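/- arXiv:1903.03951 — 3 statements merged into one kernel-verified Lean document; each statement's English description precedes it below -/
import Mathlib

section
/- Let γ : S^n → ℝ be positive and such that its positively 1-homogeneous extension γ̄ is twice continuously differentiable on ℝ^{n+1} \ {0}. Let W̃[γ] := ⋂_{ν ∈ S^n} {x ∈ ℝ^{n+1} : ⟨x, ν⟩ ≤ γ(ν)} and let W_γ be the topological frontier of W̃[γ]. Then W_γ is contained in the image ξ_γ(S^n) of the Cahn-Hoffman map ξ_γ = ∇γ̄ restricted to S^n. (Paper's Theorem 4.5 (i).) -/
open scoped RealInnerProductSpace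

/-- The Wulff body `W̃[γ] = ⋂_{‖ν‖=1} {x : ⟨x,ν⟩ ≤ γ(ν)}`, where `γ'` is the
1-homogeneous extension of the integrand `γ` (so `γ' ν = γ ν` on the unit sphere). -/
def wulffBody (n : ℕ) (γ' : EuclideanSpace ℝ (Fin (n + 1)) → ℝ) :
    Set (EuclideanSpace ℝ (Fin (n + 1))) :=
  ⋂ ν ∈ Metric.sphere (0 : EuclideanSpace ℝ (Fin (n + 1))) 1, {x | ⟪x, ν⟫ ≤ γ' ν}

theorem mem_wulffBody {n : ℕ} {γ' : EuclideanSpace ℝ (Fin (n + 1)) → ℝ}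
    {x : EuclideanSpace ℝ (Fin (n + 1))} :
    x ∈ wulffBody n γ' ↔ ∀ ν, ‖ν‖ = 1 → ⟪x, ν⟫ ≤ γ' ν := by
  simp [wulffBody]

theorem isClosed_wulffBody (n : ℕ) (γ' : EuclideanSpace ℝ (Fin (n + 1)) → ℝ) :
    IsClosed (wulffBody n γ') :=
  isClosed_biInter fun _ _ => isClosed_le (by fun_prop) continuous_const

/-- A point with a uniform positive margin in every constraint is interior to the Wulff body. -/
theorem mem_interior_wulffBody {n : ℕ} {γ' : EuclideanSpace ℝ (Fin (n + 1)) → ℝ}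
    {x : EuclideanSpace ℝ (Fin (n + 1))} {m : ℝ} (hm : 0 < m)
    (h : ∀ ν, ‖ν‖ = 1 → m ≤ γ' ν - ⟪x, ν⟫) : x ∈ interior (wulffBody n γ') := by
  refine mem_interior.2 ⟨Metric.ball x m, fun z hz => ?_, Metric.isOpen_ball,
    Metric.mem_ball_self hm⟩
  refine mem_wulffBody.2 fun ν hν => ?_
  have h1 : ⟪z - x, ν⟫ ≤ ‖z - x‖ := by
    simpa [hν] using real_inner_le_norm (z - x) ν
  rw [inner_sub_left] at h1
  rw [mem_ball_iff_norm] at hz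
  linarith [h ν hν]

/-- A function bounded below by a linear form touching it at a point of differentiability has
that form as its gradient there. -/
theorem gradient_eq_of_forall_inner_le {E : Type*} [NormedAddCommGroup E] [InnerProductSpace ℝ E]
    [CompleteSpace E] {f : E → ℝ} {x y : E} (hf : DifferentiableAt ℝ f y)
    (hle : ∀ z, ⟪x, z⟫ ≤ f z) (heq : f y = ⟪x, y⟫) : gradient f y = x := by
  have hmin : IsLocalMin (fun z => f z - innerSL ℝ x z) y :=
    Filter.Eventually.of_forall fun z => by
      simpa [heq] using hle z
  have hd := hmin.hasFDerivAt_eq_zero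
    (hf.hasGradientAt.hasFDerivAt.sub (innerSL ℝ x).hasFDerivAt)
  refine ext_inner_right ℝ fun v => ?_
  simpa [sub_eq_zero] using DFunLike.congr_fun hd v

/-- If `γ : S^n → ℝ` is positive with 1-homogeneous extension `γ̄` of
class C² away from the origin, then the Wulff shape `W_γ` (the frontier of the Wulff body)
is contained in the image of the unit sphere under the Cahn-Hoffman map `ξ_γ = ∇γ̄`.
(Paper's Theorem 4.5 (i).) -/
theorem wulffShape_subset_cahnHoffman_image
    (n : ℕ) (γ' : EuclideanSpace ℝ (Fin (n + 1)) → ℝ)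
    (hhom : ∀ r : ℝ, 0 ≤ r → ∀ x : EuclideanSpace ℝ (Fin (n + 1)), γ' (r • x) = r * γ' x)
    (hpos : ∀ ν : EuclideanSpace ℝ (Fin (n + 1)), ‖ν‖ = 1 → 0 < γ' ν)
    (hC2 : ContDiffOn ℝ 2 γ' {(0 : EuclideanSpace ℝ (Fin (n + 1)))}ᶜ) :
    frontier (wulffBody n γ') ⊆
      gradient γ' '' Metric.sphere (0 : EuclideanSpace ℝ (Fin (n + 1))) 1 := by
  intro x hx
  have hxB := mem_wulffBody.1 ((isClosed_wulffBody n γ').frontier_subset hx)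
  have hcont : ContinuousOn (fun ν => γ' ν - ⟪x, ν⟫)
      (Metric.sphere (0 : EuclideanSpace ℝ (Fin (n + 1))) 1) := by
    refine (hC2.continuousOn.mono fun ν hν => ?_).sub (by fun_prop)
    exact ne_zero_of_mem_unit_sphere ⟨ν, hν⟩
  obtain ⟨ν, hν, hmin⟩ := (isCompact_sphere _ _).exists_isMinOn
    (NormedSpace.sphere_nonempty.2 zero_le_one) hcont
  have hν1 : ‖ν‖ = 1 := by simpa using hν
  have hν0 : ν ≠ 0 := ne_zero_of_mem_unit_sphere ⟨ν, hν⟩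
  refine ⟨ν, hν, gradient_eq_of_forall_inner_le ?_ (fun z => ?_) ?_⟩
  · exact (hC2.contDiffAt (isOpen_compl_singleton.mem_nhds hν0)).differentiableAt (by norm_num)
  · rcases eq_or_ne z 0 with rfl | hz
    · simpa using (hhom 0 le_rfl 0).ge
    · have hz' := norm_ne_zero_iff.2 hz
      have h1 := hxB (‖z‖⁻¹ • z) (by simp [norm_smul, hz'])
      rw [hhom _ (by positivity), real_inner_smul_right] at h1
      exact le_of_mul_le_mul_left h1 (by positivity)
  · by_contra hne
    have hlt : 0 < γ' ν - ⟪x, ν⟫ := sub_pos.2 (lt_of_le_of_ne (hxB ν hν1) (Ne.symm hne))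
    exact hx.2 (mem_interior_wulffBody hlt fun μ hμ => hmin (by simpa using hμ))
end

section
/- Fix an integer m ≥ 1 and define γ̄_m : ℝ² → ℝ by γ̄_m(x₁, x₂) = (x₁^{2m} + x₂^{2m})^{1/(2m)}. Then for every (x₁, x₂) ≠ (0,0), the Laplacian of γ̄_m satisfies Δγ̄_m(x₁, x₂) = ∂²γ̄_m/∂x₁² + ∂²γ̄_m/∂x₂² = (2m − 1)·x₁^{2m−2}·x₂^{2m−2}·(x₁² + x₂²)·(x₁^{2m} + x₂^{2m})^{(1/(2m)) − 2}. Consequently (restricting to the unit circle) d ξ_m = D²γ_m + γ_m·1 vanishes at θ = ℓπ/2 (ℓ ∈ ℤ) when m ≥ 2 and is positive elsewhere. (Paper's computation in Appendix A for Example 7.5.) -/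
open Real

/-- The two-variable function `γ̄_m(a, b) = (a^{2m} + b^{2m})^{1/(2m)}`, the homogeneous
extension of the integrand `γ_m` of Example 7.5. -/
noncomputable def gammaExt2 (m : ℕ) (a b : ℝ) : ℝ :=
  (a ^ (2 * m) + b ^ (2 * m)) ^ ((1 : ℝ) / (2 * m))

/-- `A_m(θ) = (2m−1)·cos^{2m−2}θ·sin^{2m−2}θ·(cos^{2m}θ + sin^{2m}θ)^{1/(2m)−2}`, the
value of `dξ_m = D²γ_m + γ_m·1` on the unit circle in Example 7.5. -/
noncomputable def Am (m : ℕ) (θ : ℝ) : ℝ :=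
  (2 * (m : ℝ) - 1) * Real.cos θ ^ (2 * m - 2) * Real.sin θ ^ (2 * m - 2) *
    (Real.cos θ ^ (2 * m) + Real.sin θ ^ (2 * m)) ^ ((1 : ℝ) / (2 * m) - 2)

/-- The second derivative of `u ↦ (u ^ n + c) ^ (1 / n)` at a point where the base is positive. -/
lemma deriv_deriv_pow_add_const_rpow_inv {n : ℕ} (hn : 2 ≤ n) (c a : ℝ) (h : 0 < a ^ n + c) :
    deriv (deriv fun u : ℝ => (u ^ n + c) ^ ((1 : ℝ) / n)) a =
      ((n : ℝ) - 1) * a ^ (n - 2) * c * (a ^ n + c) ^ ((1 : ℝ) / n - 2) := by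
  obtain ⟨k, rfl⟩ := Nat.exists_eq_add_of_le' hn
  have hk : ((k + 2 : ℕ) : ℝ) ≠ 0 := by positivity
  have hbase (u : ℝ) :
      HasDerivAt (fun u : ℝ => u ^ (k + 2) + c) (((k + 2 : ℕ) : ℝ) * u ^ (k + 1)) u :=
    (hasDerivAt_pow (k + 2) u).add_const c
  have hcont : Continuous fun u : ℝ => u ^ (k + 2) + c := by fun_prop
  have hfirst : deriv (fun u : ℝ => (u ^ (k + 2) + c) ^ ((1 : ℝ) / (k + 2 : ℕ))) =ᶠ[nhds a]
      fun u => u ^ (k + 1) * (u ^ (k + 2) + c) ^ ((1 : ℝ) / (k + 2 : ℕ) - 1) := by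
    filter_upwards [hcont.continuousAt.eventually (lt_mem_nhds h)] with u hu
    rw [((hbase u).rpow_const (Or.inl hu.ne')).deriv]
    field_simp
  have hsecond := (hasDerivAt_pow (k + 1) a).mul
    ((hbase a).rpow_const (p := (1 : ℝ) / (k + 2 : ℕ) - 1) (Or.inl h.ne'))
  have hsplit : (a ^ (k + 2) + c) ^ ((1 : ℝ) / (k + 2 : ℕ) - 1) =
      (a ^ (k + 2) + c) ^ ((1 : ℝ) / (k + 2 : ℕ) - 2) * (a ^ (k + 2) + c) := by
    rw [← Real.rpow_add_one h.ne']
    congr 1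
    ring
  rw [hfirst.deriv_eq]
  refine hsecond.deriv.trans ?_
  rw [hsplit, show (1 : ℝ) / (k + 2 : ℕ) - 1 - 1 = (1 : ℝ) / (k + 2 : ℕ) - 2 by ring]
  generalize (a ^ (k + 2) + c) ^ ((1 : ℝ) / (k + 2 : ℕ) - 2) = R
  simp only [Nat.add_sub_cancel]
  field_simp
  push_cast
  ring

/-- The sum of two equal even powers is positive away from the origin. -/
lemma pow_two_mul_add_pow_two_mul_pos (m : ℕ) {a b : ℝ} (h : ¬(a = 0 ∧ b = 0)) :
    0 < a ^ (2 * m) + b ^ (2 * m) := by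
  have ha : 0 ≤ a ^ (2 * m) := (even_two_mul m).pow_nonneg a
  have hb : 0 ≤ b ^ (2 * m) := (even_two_mul m).pow_nonneg b
  rcases not_and_or.mp h with h | h
  · exact add_pos_of_pos_of_nonneg ((even_two_mul m).pow_pos h) hb
  · exact add_pos_of_nonneg_of_pos ha ((even_two_mul m).pow_pos h)

/-- `γ̄_m` is symmetric in its two variables. -/
lemma gammaExt2_comm (m : ℕ) (a b : ℝ) : gammaExt2 m a b = gammaExt2 m b a := by
  rw [gammaExt2, gammaExt2, add_comm]

/-- The pure second partial derivative of `γ̄_m` in its first variable. -/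
lemma deriv_deriv_gammaExt2 {m : ℕ} (hm : 1 ≤ m) {a b : ℝ} (h : ¬(a = 0 ∧ b = 0)) :
    deriv (deriv fun u => gammaExt2 m u b) a =
      (2 * (m : ℝ) - 1) * a ^ (2 * m - 2) * b ^ (2 * m) *
        (a ^ (2 * m) + b ^ (2 * m)) ^ ((1 : ℝ) / (2 * m) - 2) := by
  have := deriv_deriv_pow_add_const_rpow_inv (n := 2 * m) (by omega) (b ^ (2 * m)) a
    (pow_two_mul_add_pow_two_mul_pos m h)
  push_cast at this
  exact this

/-- `A_m` vanishes at the multiples of `π / 2` when `m ≥ 2`. -/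
lemma Am_int_mul_pi_div_two {m : ℕ} (hm : 2 ≤ m) (l : ℤ) :
    Am m ((l : ℝ) * (Real.pi / 2)) = 0 := by
  have hsin : Real.sin (2 * ((l : ℝ) * (Real.pi / 2))) = 0 := by
    rw [show 2 * ((l : ℝ) * (Real.pi / 2)) = l * Real.pi by ring, Real.sin_int_mul_pi]
  have hexp : 2 * m - 2 ≠ 0 := by omega
  rw [Real.sin_two_mul] at hsin
  rcases mul_eq_zero.mp hsin with h | h
  · have h' : Real.sin ((l : ℝ) * (Real.pi / 2)) = 0 := by linarith
    rw [Am, h', zero_pow hexp]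
    ring
  · rw [Am, h, zero_pow hexp]
    ring

/-- `A_m` is positive away from the multiples of `π / 2`. -/
lemma Am_pos {m : ℕ} (hm : 1 ≤ m) {θ : ℝ} (hθ : ¬∃ l : ℤ, θ = (l : ℝ) * (Real.pi / 2)) :
    0 < Am m θ := by
  have hsin : Real.sin θ ≠ 0 := fun h => by
    obtain ⟨n, hn⟩ := Real.sin_eq_zero_iff.mp h
    exact hθ ⟨2 * n, by rw [← hn]; push_cast; ring⟩
  have hcos : Real.cos θ ≠ 0 := fun h => by
    obtain ⟨n, hn⟩ := Real.cos_eq_zero_iff.mp h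
    exact hθ ⟨2 * n + 1, by rw [hn]; push_cast; ring⟩
  have hm' : (1 : ℝ) ≤ m := by exact_mod_cast hm
  have heven : Even (2 * m - 2) := ⟨m - 1, by omega⟩
  have hcoef : 0 < 2 * (m : ℝ) - 1 := by linarith
  exact mul_pos (mul_pos (mul_pos hcoef (heven.pow_pos hcos)) (heven.pow_pos hsin))
    (Real.rpow_pos_of_pos (pow_two_mul_add_pow_two_mul_pos m fun h => hsin h.2) _)

/-- For `m ≥ 1` and `(a,b) ≠ (0,0)`, the Laplacian of
`γ̄_m(a,b) = (a^{2m} + b^{2m})^{1/(2m)}` equals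
`(2m−1)·a^{2m−2}·b^{2m−2}·(a² + b²)·(a^{2m} + b^{2m})^{1/(2m)−2}`. Consequently, on the
unit circle, `dξ_m = D²γ_m + γ_m·1` vanishes at `θ = ℓπ/2` (`ℓ ∈ ℤ`) when `m ≥ 2`, and is
positive at every other `θ`. (Paper's Appendix A, computations for Example 7.5.) -/
theorem laplacian_gammaExt (m : ℕ) (hm : 1 ≤ m) :
    (∀ a b : ℝ, ¬(a = 0 ∧ b = 0) →
      deriv (deriv (fun u => gammaExt2 m u b)) a +
        deriv (deriv (fun u => gammaExt2 m a u)) b =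
      (2 * (m : ℝ) - 1) * a ^ (2 * m - 2) * b ^ (2 * m - 2) * (a ^ 2 + b ^ 2) *
        (a ^ (2 * m) + b ^ (2 * m)) ^ ((1 : ℝ) / (2 * m) - 2)) ∧
    (2 ≤ m → ∀ ℓ : ℤ, Am m ((ℓ : ℝ) * (Real.pi / 2)) = 0) ∧
    (∀ θ : ℝ, (¬∃ ℓ : ℤ, θ = (ℓ : ℝ) * (Real.pi / 2)) → 0 < Am m θ) := by
  refine ⟨fun a b h => ?_, fun h2 l => Am_int_mul_pi_div_two h2 l, fun θ hθ => Am_pos hm hθ⟩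
  have hpow (x : ℝ) : x ^ (2 * m) = x ^ (2 * m - 2) * x ^ 2 := by
    rw [← pow_add, Nat.sub_add_cancel (by omega)]
  simp_rw [gammaExt2_comm m a]
  rw [deriv_deriv_gammaExt2 hm h, deriv_deriv_gammaExt2 hm fun h' => h h'.symm,
    add_comm (b ^ (2 * m))]
  generalize (a ^ (2 * m) + b ^ (2 * m)) ^ ((1 : ℝ) / (2 * m) - 2) = R
  rw [hpow a, hpow b]
  ring
end

section
/- Fix an integer m ≥ 1 and define f_m, g_m : ℝ → ℝ by f_m(θ) = (cos^{2m}θ + sin^{2m}θ)^{(1/(2m)) − 1}·cos^{2m−1}θ and g_m(θ) = (cos^{2m}θ + sin^{2m}θ)^{(1/(2m)) − 1}·sin^{2m−1}θ (the components of the Cahn-Hoffman map ξ_m of γ_m). Then for all θ ∈ ℝ, −f_m′(θ)·g_m″(θ) + f_m″(θ)·g_m′(θ) = −((f_m′(θ))² + (g_m′(θ))²). Equivalently, the curvature of ξ_m with respect to the outward normal satisfies κ_m·ds = −dθ, so that ∫₀^{2π} κ_m ds = −2π even though κ_m is unbounded near θ = ℓπ/2 for m ≥ 2. (Paper's computation (B.9)–(B.15)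 in Appendix A for Example 7.5.) -/
open Real

/-- First component of the Cahn-Hoffman map `ξ_m` of `γ_m` in Example 7.5:
`f_m(θ) = (cos^{2m}θ + sin^{2m}θ)^{1/(2m)−1}·cos^{2m−1}θ`. -/
noncomputable def fm (m : ℕ) (θ : ℝ) : ℝ :=
  (Real.cos θ ^ (2 * m) + Real.sin θ ^ (2 * m)) ^ ((1 : ℝ) / (2 * m) - 1) *
    Real.cos θ ^ (2 * m - 1)

/-- Second component of the Cahn-Hoffman map `ξ_m` of `γ_m` in Example 7.5:
`g_m(θ) = (cos^{2m}θ + sin^{2m}θ)^{1/(2m)−1}·sin^{2m−1}θ`. -/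
noncomputable def gm (m : ℕ) (θ : ℝ) : ℝ :=
  (Real.cos θ ^ (2 * m) + Real.sin θ ^ (2 * m)) ^ ((1 : ℝ) / (2 * m) - 1) *
    Real.sin θ ^ (2 * m - 1)

/-- The sum `cos^{2m}θ + sin^{2m}θ` is positive. -/
lemma cos_pow_add_sin_pow_pos (m : ℕ) (θ : ℝ) : 0 < cos θ ^ (2 * m) + sin θ ^ (2 * m) := by
  have hc : 0 ≤ cos θ ^ (2 * m) := (even_two_mul m).pow_nonneg _
  have hs : 0 ≤ sin θ ^ (2 * m) := (even_two_mul m).pow_nonneg _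
  by_cases h : cos θ = 0
  · have hs' : sin θ ≠ 0 := by
      intro h'
      have := sin_sq_add_cos_sq θ
      simp [h, h'] at this
    exact add_pos_of_nonneg_of_pos hc ((even_two_mul m).pow_pos hs')
  · exact add_pos_of_pos_of_nonneg ((even_two_mul m).pow_pos h) hs

/-- The signed speed of `ξ_m` along `(-sin θ, cos θ)`. -/
noncomputable def speed (m : ℕ) (θ : ℝ) : ℝ :=
  (2 * m - 1) * (cos θ ^ (2 * m) + sin θ ^ (2 * m)) ^ ((1 : ℝ) / (2 * m) - 1 - 1) *
    (sin θ * cos θ) ^ (2 * m - 2)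

lemma hasDerivAt_cos_pow_add_sin_pow (m : ℕ) (θ : ℝ) :
    HasDerivAt (fun x => cos x ^ (2 * m) + sin x ^ (2 * m))
      (2 * m * (sin θ ^ (2 * m - 1) * cos θ - cos θ ^ (2 * m - 1) * sin θ)) θ := by
  refine (((hasDerivAt_cos θ).pow (2 * m)).add ((hasDerivAt_sin θ).pow (2 * m))).congr_deriv ?_
  push_cast
  ring

lemma hasDerivAt_fm {m : ℕ} (hm : 1 ≤ m) (θ : ℝ) :
    HasDerivAt (fm m) (-(speed m θ * sin θ)) θ := by
  have hA := cos_pow_add_sin_pow_pos m θ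
  have h := ((hasDerivAt_cos_pow_add_sin_pow m θ).rpow_const (p := (1 : ℝ) / (2 * m) - 1)
    (Or.inl hA.ne')).mul ((hasDerivAt_cos θ).pow (2 * m - 1))
  refine h.congr_deriv ?_
  have hsplit := rpow_sub_one hA.ne' ((1 : ℝ) / (2 * m) - 1)
  have hB : (cos θ ^ (2 * m) + sin θ ^ (2 * m)) ^ ((1 : ℝ) / (2 * m) - 1) =
      (cos θ ^ (2 * m) + sin θ ^ (2 * m)) ^ ((1 : ℝ) / (2 * m) - 1 - 1) *
        (cos θ ^ (2 * m) + sin θ ^ (2 * m)) := by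
    rw [hsplit, div_mul_cancel₀ _ hA.ne']
  obtain ⟨n, rfl⟩ : ∃ n, m = n + 1 := ⟨m - 1, by lia⟩
  simp only [Pi.pow_apply, speed]
  rw [hB]
  generalize (cos θ ^ (2 * (n + 1)) + sin θ ^ (2 * (n + 1))) ^
    ((1 : ℝ) / (2 * (n + 1 : ℕ)) - 1 - 1) = B
  have e1 : 2 * (n + 1) - 1 = 2 * n + 1 := by lia
  have e2 : 2 * (n + 1) - 2 = 2 * n := by lia
  have e3 : 2 * n + 1 - 1 = 2 * n := by lia
  have hn : (n : ℝ) + 1 ≠ 0 := by positivity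
  rw [e1, e2, e3]
  push_cast
  have hcs := sin_sq_add_cos_sq θ
  have hk : 2 * ((n : ℝ) + 1) * (1 / (2 * (n + 1)) - 1) = -(2 * n + 1) := by
    field_simp
    ring
  linear_combination
    -(2 * n + 1) * B * (sin θ * cos θ) ^ (2 * n) * sin θ * hcs +
    (sin θ ^ (2 * n + 1) * cos θ - cos θ ^ (2 * n + 1) * sin θ) * B * cos θ ^ (2 * n + 1) * hk

lemma hasDerivAt_gm {m : ℕ} (hm : 1 ≤ m) (θ : ℝ) :
    HasDerivAt (gm m) (speed m θ * cos θ) θ := by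
  have hfg : gm m = fun x => fm m (π / 2 - x) := by
    funext x
    simp only [fm, gm, cos_pi_div_two_sub, sin_pi_div_two_sub]
    rw [add_comm]
  have h := (hasDerivAt_fm hm (π / 2 - θ)).comp_const_sub (π / 2) θ
  rw [hfg]
  refine h.congr_deriv ?_
  simp only [speed, cos_pi_div_two_sub, sin_pi_div_two_sub, neg_neg]
  rw [add_comm, mul_comm (sin θ)]

lemma differentiable_speed (m : ℕ) : Differentiable ℝ (speed m) := by
  intro θ
  have h := (hasDerivAt_cos_pow_add_sin_pow m θ).differentiableAt.rpow_const
    (p := (1 : ℝ) / (2 * m) - 1 - 1) (Or.inl (cos_pow_add_sin_pow_pos m θ).ne')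
  unfold speed
  fun_prop

lemma speed_ne_zero {m : ℕ} (hm : 1 ≤ m) {θ : ℝ} (hs : sin θ ≠ 0) (hc : cos θ ≠ 0) :
    speed m θ ≠ 0 := by
  have hm' : (1 : ℝ) ≤ m := by exact_mod_cast hm
  have h1 : (2 * m - 1 : ℝ) ≠ 0 := by linarith
  exact mul_ne_zero (mul_ne_zero h1 (rpow_pos_of_pos (cos_pow_add_sin_pow_pos m θ) _).ne')
    (pow_ne_zero _ (mul_ne_zero hs hc))

lemma countable_sin_or_cos_eq_zero : {θ : ℝ | sin θ = 0 ∨ cos θ = 0}.Countable := by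
  refine ((Set.countable_range fun n : ℤ => (n : ℝ) * π).union
    (Set.countable_range fun k : ℤ => (2 * (k : ℝ) + 1) * π / 2)).mono ?_
  rintro θ (h | h)
  · exact Or.inl (sin_eq_zero_iff.1 h)
  · obtain ⟨k, hk⟩ := cos_eq_zero_iff.1 h
    exact Or.inr ⟨k, hk.symm⟩

/-- For the components `(f_m, g_m)` of the Cahn-Hoffman map `ξ_m` of
Example 7.5 one has `−f_m′·g_m″ + f_m″·g_m′ = −((f_m′)² + (g_m′)²)` identically;
equivalently `κ_m ds = −dθ`, so the total curvature is
`∫₀^{2π} κ_m ds = −2π`. (Paper's Appendix A, computations for Example 7.5.) -/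
theorem curvature_identity_xi_m (m : ℕ) (hm : 1 ≤ m) :
    (∀ θ : ℝ,
      -(deriv (fm m) θ) * deriv (deriv (gm m)) θ +
        deriv (deriv (fm m)) θ * deriv (gm m) θ =
      -((deriv (fm m) θ) ^ 2 + (deriv (gm m) θ) ^ 2)) ∧
    (∫ θ in (0 : ℝ)..(2 * Real.pi),
        (-(deriv (fm m) θ) * deriv (deriv (gm m)) θ +
          deriv (deriv (fm m)) θ * deriv (gm m) θ) /
          ((deriv (fm m) θ) ^ 2 + (deriv (gm m) θ) ^ 2)) = -(2 * Real.pi) := by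
  have hf : deriv (fm m) = fun θ => -(speed m θ * sin θ) :=
    funext fun θ => (hasDerivAt_fm hm θ).deriv
  have hg : deriv (gm m) = fun θ => speed m θ * cos θ :=
    funext fun θ => (hasDerivAt_gm hm θ).deriv
  have hsq : ∀ θ, (deriv (fm m) θ) ^ 2 + (deriv (gm m) θ) ^ 2 = speed m θ ^ 2 := by
    intro θ
    rw [hf, hg]
    linear_combination speed m θ ^ 2 * sin_sq_add_cos_sq θ
  have key : ∀ θ : ℝ,
      -(deriv (fm m) θ) * deriv (deriv (gm m)) θ +
        deriv (deriv (fm m)) θ * deriv (gm m) θ =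
      -((deriv (fm m) θ) ^ 2 + (deriv (gm m) θ) ^ 2) := by
    intro θ
    have hρ := (differentiable_speed m θ).hasDerivAt
    have hf' := (hρ.mul (hasDerivAt_sin θ)).neg.deriv
    have hg' := (hρ.mul (hasDerivAt_cos θ)).deriv
    rw [hsq, hf, hg]
    change _ * deriv (speed m * cos) θ + deriv (-(speed m * sin)) θ * _ = _
    rw [hf', hg']
    linear_combination -speed m θ ^ 2 * sin_sq_add_cos_sq θ
  refine ⟨key, ?_⟩
  have hae : ∀ᵐ θ : ℝ, θ ∈ Set.uIoc 0 (2 * π) →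
      (-(deriv (fm m) θ) * deriv (deriv (gm m)) θ +
          deriv (deriv (fm m)) θ * deriv (gm m) θ) /
          ((deriv (fm m) θ) ^ 2 + (deriv (gm m) θ) ^ 2) = -1 := by
    filter_upwards [countable_sin_or_cos_eq_zero.ae_notMem MeasureTheory.volume] with θ hθ _
    simp only [not_or] at hθ
    rw [key, neg_div, hsq, div_self (pow_ne_zero 2 (speed_ne_zero hm hθ.1 hθ.2))]
  rw [intervalIntegral.integral_congr_ae hae]
  simp
end
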